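/- Fix B_x, B_w, B_y > 0, η₂ > 0, ε > 0, and let R = max(B_w B_x, B_y, 1). Let ℓ: ℝ × ℝ → [0,∞) be differentiable in its first argument, and suppose the map (s, t, u) ↦ u·∂₁ℓ(s, t) is (ε, R, M, C)-approximable by sum of ReLUs. Then there exists an attention block with M heads such that, for every input and every α, w ∈ ℝ^J satisfying ‖φ(x_i)‖₂ ≤ B_x and ≤ 1, |y_i| ≤ B_y, ‖w‖₂ ≤ B_w, and |α^⊤φ(x_i)| ≤ R for all i ≤ N+1, the block maps the tokens h_i = [z_i, φ(x_i), α, w, 0] to h̃_i = [z_i, φ(x_i), α, w′, 0] for all i = 1,…,N+1, where w′ = w − η₂ ∇R̂_T(w) + ε′ with ‖ε′‖₂ ≤ ε η₂ B_x, and R̂_T(w) = (1/n) Σ_{i=1}^n (α^⊤φ(x_i)) ℓ(w^⊤φ(x_i), y_i) is the importance-weighted empirical risk with weights q̂_α(x) = α^⊤φ(x). -/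

import Mathlib

open Matrix Finset

noncomputable section

/-- The ReLU activation `σ(z) = max(z,0)`. -/
def relu (z : ℝ) : ℝ := max z 0

/-- Euclidean (`ℓ²`) norm of a vector in `ℝᵏ`. -/
def l2norm {k : ℕ} (v : Fin k → ℝ) : ℝ := Real.sqrt (∑ i, v i ^ 2)

/-- `g : ℝᵏ → ℝ` is `(ε, R, M, C)`-approximable by sum of ReLUs. -/
def ApproxSumReLU {k : ℕ} (g : (Fin k → ℝ) → ℝ) (ε R : ℝ) (M : ℕ) (C : ℝ) : Prop :=
  ∃ (a : Fin M → Fin k → ℝ) (b c : Fin M → ℝ),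
    (∑ m, |c m|) ≤ C ∧ (∀ m, (∑ i, |a m i|) + |b m| ≤ 1) ∧
    ∀ z : Fin k → ℝ, (∀ i, |z i| ≤ R) →
      |g z - ∑ m, c m * relu (a m ⬝ᵥ z + b m)| ≤ ε

/-- A self-attention block with `M` heads on `D`-dimensional tokens of length `N+1`. -/
def attn {D M N : ℕ} (Q K V : Fin M → Matrix (Fin D) (Fin D) ℝ)
    (h : Fin (N + 1) → Fin D → ℝ) : Fin (N + 1) → Fin D → ℝ :=
  fun i => h i + ((N : ℝ) + 1)⁻¹ •
    ∑ j, ∑ m, relu ((Q m).mulVec (h i) ⬝ᵥ (K m).mulVec (h j)) • (V m).mulVec (h j)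

/-- Token layout `[xᵢ, yᵢ, tᵢ, sᵢ, 1, a, b, c, 0_p]` with three `J`-blocks (features `φ(xᵢ)`,
density-ratio parameter `α`, model weight `w`) and `p` padding zeros. -/
def tok {d J p : ℕ} (x : Fin d → ℝ) (y t s : ℝ) (a b c : Fin J → ℝ) :
    Fin (d + 4 + J + J + J + p) → ℝ :=
  Fin.append (Fin.append (Fin.append (Fin.append (Fin.append x ![y, t, s, 1]) a) b) c)
    (0 : Fin p → ℝ)

/-- The token layout with an arbitrary block of four scalar coordinates. -/
def blockVec {d J p : ℕ} (x : Fin d → ℝ) (q : Fin 4 → ℝ) (a b c : Fin J → ℝ) :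
    Fin (d + 4 + J + J + J + p) → ℝ :=
  Fin.append (Fin.append (Fin.append (Fin.append (Fin.append x q) a) b) c) (0 : Fin p → ℝ)

theorem append_add_append {m k : ℕ} (a a' : Fin m → ℝ) (b b' : Fin k → ℝ) :
    Fin.append a b + Fin.append a' b' = Fin.append (a + a') (b + b') := by
  ext i
  refine Fin.addCases ?_ ?_ i <;> simp

theorem smul_append {m k : ℕ} (r : ℝ) (a : Fin m → ℝ) (b : Fin k → ℝ) :
    r • Fin.append a b = Fin.append (r • a) (r • b) := by
  ext i
  refine Fin.addCases ?_ ?_ i <;> simp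

theorem append_dotProduct_append {m k : ℕ} (a a' : Fin m → ℝ) (b b' : Fin k → ℝ) :
    Fin.append a b ⬝ᵥ Fin.append a' b' = a ⬝ᵥ a' + b ⬝ᵥ b' := by
  simp [dotProduct, Fin.sum_univ_add]

/-- `blockVec` with all blocks depending linearly on a vector. -/
def blockLin {E : Type*} [AddCommGroup E] [Module ℝ E] {d J : ℕ} (p : ℕ)
    (x : E →ₗ[ℝ] Fin d → ℝ) (q : E →ₗ[ℝ] Fin 4 → ℝ) (a b c : E →ₗ[ℝ] Fin J → ℝ) :
    E →ₗ[ℝ] Fin (d + 4 + J + J + J + p) → ℝ where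
  toFun h := blockVec (x h) (q h) (a h) (b h) (c h)
  map_add' h h' := by simp [blockVec, append_add_append]
  map_smul' r h := by simp [blockVec, smul_append]

/-- The four scalar coordinates `y, t, s, 1` of a token. -/
def scalarPart (d J p : ℕ) : (Fin (d + 4 + J + J + J + p) → ℝ) →ₗ[ℝ] Fin 4 → ℝ :=
  LinearMap.funLeft ℝ ℝ fun i =>
    Fin.castAdd p (Fin.castAdd J (Fin.castAdd J (Fin.castAdd J (Fin.natAdd d i))))

/-- The feature block of a token. -/
def featurePart (d J p : ℕ) : (Fin (d + 4 + J + J + J + p) → ℝ) →ₗ[ℝ] Fin J → ℝ :=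
  LinearMap.funLeft ℝ ℝ fun i =>
    Fin.castAdd p (Fin.castAdd J (Fin.castAdd J (Fin.natAdd (d + 4) i)))

/-- The density-ratio parameter block of a token. -/
def ratioPart (d J p : ℕ) : (Fin (d + 4 + J + J + J + p) → ℝ) →ₗ[ℝ] Fin J → ℝ :=
  LinearMap.funLeft ℝ ℝ fun i => Fin.castAdd p (Fin.castAdd J (Fin.natAdd (d + 4 + J) i))

/-- The model weight block of a token. -/
def weightPart (d J p : ℕ) : (Fin (d + 4 + J + J + J + p) → ℝ) →ₗ[ℝ] Fin J → ℝ :=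
  LinearMap.funLeft ℝ ℝ fun i => Fin.castAdd p (Fin.natAdd (d + 4 + J + J) i)

section Parts

variable {d J p : ℕ} (x : Fin d → ℝ) (y t s : ℝ) (a b c : Fin J → ℝ)

theorem scalarPart_tok : scalarPart d J p (tok x y t s a b c) = ![y, t, s, 1] := by
  ext i
  simp [scalarPart, tok, LinearMap.funLeft_apply]

theorem featurePart_tok : featurePart d J p (tok x y t s a b c) = a := by
  ext i
  simp [featurePart, tok, LinearMap.funLeft_apply]

theorem ratioPart_tok : ratioPart d J p (tok x y t s a b c) = b := by
  ext i
  simp [ratioPart, tok, LinearMap.funLeft_apply]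

theorem weightPart_tok : weightPart d J p (tok x y t s a b c) = c := by
  ext i
  simp [weightPart, tok, LinearMap.funLeft_apply]

end Parts

/-- The linear embedding of `ℝᴶ` as the model weight block. -/
def weightEmb (d J p : ℕ) : (Fin J → ℝ) →ₗ[ℝ] Fin (d + 4 + J + J + J + p) → ℝ :=
  blockLin p 0 0 0 0 LinearMap.id

theorem tok_add_weightEmb {d J p : ℕ} (x : Fin d → ℝ) (y t s : ℝ) (a b c v : Fin J → ℝ) :
    tok (p := p) x y t s a b c + weightEmb d J p v = tok x y t s a b (c + v) := by
  simp [tok, weightEmb, blockLin, blockVec, append_add_append]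

/-- Query map of the head with inner ReLU weights `a` and bias `b`, gated at level `R`. -/
def queryLin (d J p : ℕ) (a : Fin 3 → ℝ) (b R : ℝ) :
    (Fin (d + 4 + J + J + J + p) → ℝ) →ₗ[ℝ] Fin (d + 4 + J + J + J + p) → ℝ :=
  blockLin p 0
    (((LinearMap.proj 3 : (Fin 4 → ℝ) →ₗ[ℝ] ℝ).smulRight ![a 1, R, 0, b - R]) ∘ₗ scalarPart d J p)
    0 (a 2 • ratioPart d J p) (a 0 • weightPart d J p)

/-- Key map shared by all heads. -/
def keyLin (d J p : ℕ) :
    (Fin (d + 4 + J + J + J + p) → ℝ) →ₗ[ℝ] Fin (d + 4 + J + J + J + p) → ℝ :=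
  blockLin p 0 (scalarPart d J p) 0 (featurePart d J p) (featurePart d J p)

theorem queryLin_dotProduct_keyLin {d J p : ℕ} (a : Fin 3 → ℝ) (b R : ℝ)
    (x x' : Fin d → ℝ) (y t s y' t' s' : ℝ) (φ φ' α w : Fin J → ℝ) :
    queryLin d J p a b R (tok x y t s φ α w) ⬝ᵥ keyLin d J p (tok x' y' t' s' φ' α w) =
      a ⬝ᵥ ![w ⬝ᵥ φ', y', α ⬝ᵥ φ'] + b - R * (1 - t') := by
  simp only [queryLin, keyLin, blockLin, LinearMap.coe_mk, AddHom.coe_mk, blockVec,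
    append_dotProduct_append, LinearMap.comp_apply, LinearMap.smulRight_apply,
    LinearMap.smul_apply, LinearMap.zero_apply, LinearMap.proj_apply,
    scalarPart_tok, featurePart_tok, ratioPart_tok, weightPart_tok, zero_dotProduct,
    smul_dotProduct]
  simp [dotProduct, Fin.sum_univ_four, Fin.sum_univ_three]
  ring

theorem l2norm_eq_norm {k : ℕ} (v : Fin k → ℝ) : l2norm v = ‖WithLp.toLp 2 v‖ := by
  simp [l2norm, EuclideanSpace.norm_eq]

theorem l2norm_smul {k : ℕ} (r : ℝ) (v : Fin k → ℝ) : l2norm (r • v) = |r| * l2norm v := by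
  rw [l2norm_eq_norm, l2norm_eq_norm, WithLp.toLp_smul, norm_smul, Real.norm_eq_abs]

theorem l2norm_sum_le {k : ℕ} {ι : Type*} (s : Finset ι) (v : ι → Fin k → ℝ) :
    l2norm (∑ i ∈ s, v i) ≤ ∑ i ∈ s, l2norm (v i) := by
  simp only [l2norm_eq_norm, WithLp.toLp_sum]
  exact norm_sum_le _ _

theorem abs_dotProduct_le {k : ℕ} (v w : Fin k → ℝ) : |v ⬝ᵥ w| ≤ l2norm v * l2norm w := by
  rw [l2norm_eq_norm, l2norm_eq_norm]
  simpa [dotProduct, PiLp.inner_apply, mul_comm] using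
    abs_real_inner_le_norm (WithLp.toLp 2 v) (WithLp.toLp 2 w)

/-- An affine form with `ℓ¹`-normalised coefficients is at most `R` on the cube `[-R, R]ᵏ`. -/
theorem dotProduct_add_le {k : ℕ} {a z : Fin k → ℝ} {b R : ℝ} (hR : 1 ≤ R)
    (hab : (∑ i, |a i|) + |b| ≤ 1) (hz : ∀ i, |z i| ≤ R) : a ⬝ᵥ z + b ≤ R := by
  have hdot : a ⬝ᵥ z ≤ (∑ i, |a i|) * R := by
    rw [sum_mul]
    refine sum_le_sum fun i _ => (le_abs_self _).trans ?_
    rw [abs_mul]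
    exact mul_le_mul_of_nonneg_left (hz i) (abs_nonneg _)
  nlinarith [le_abs_self b, abs_nonneg b]

/-- **One attention layer implements one importance-weighted gradient step.**  If
`(s,t,u) ↦ u·∂₁ℓ(s,t)` is `(ε,R,M,C)`-approximable by sum of ReLUs with
`R = max(B_w B_x, B_y, 1)`, there is an `M`-head attention block mapping
`[zᵢ, φ(xᵢ), α, w, 0]` to `[zᵢ, φ(xᵢ), α, w′, 0]` with
`w′ = w − η₂ ∇R̂_T(w) + ε′`, `‖ε′‖₂ ≤ ε η₂ B_x`, where
`R̂_T(w) = (1/n) Σ_{i≤n} (α⊤φ(xᵢ)) ℓ(w⊤φ(xᵢ), yᵢ)`. -/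
theorem attention_implements_iwl_gradient_step
    (n n' d J p : ℕ) (hn : 0 < n) (hn' : 0 < n')
    (B_x B_w B_y η₂ ε : ℝ) (hBx : 0 < B_x) (hBw : 0 < B_w) (hBy : 0 < B_y)
    (hη₂ : 0 < η₂) (hε : 0 < ε)
    (M : ℕ) (C : ℝ)
    (ℓ : ℝ → ℝ → ℝ) (hℓ0 : ∀ s t, 0 ≤ ℓ s t)
    (dℓ : ℝ → ℝ → ℝ) (hdℓ : ∀ s t, HasDerivAt (fun s' => ℓ s' t) (dℓ s t) s)
    (happrox : ApproxSumReLU (fun z : Fin 3 → ℝ => z 2 * dℓ (z 0) (z 1)) ε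
      (max (B_w * B_x) (max B_y 1)) M C) :
    ∃ Q K V : Fin M → Matrix (Fin (d + 4 + J + J + J + p)) (Fin (d + 4 + J + J + J + p)) ℝ,
      ∀ (x : Fin (n + n' + 1) → Fin d → ℝ) (y : Fin (n + n' + 1) → ℝ)
        (φx : Fin (n + n' + 1) → Fin J → ℝ) (α w : Fin J → ℝ),
        (∀ i : Fin (n + n' + 1), n ≤ (i : ℕ) → y i = 0) →
        (∀ i, l2norm (φx i) ≤ B_x) →
        (∀ i, l2norm (φx i) ≤ 1) →
        (∀ i, |y i| ≤ B_y) →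
        l2norm w ≤ B_w →
        (∀ i, |α ⬝ᵥ φx i| ≤ max (B_w * B_x) (max B_y 1)) →
        ∃ w' ε' : Fin J → ℝ,
          (attn Q K V fun i =>
              tok (x i) (y i) (if (i : ℕ) < n then 1 else 0)
                (if (i : ℕ) < n + n' then 1 else 0) (φx i) α w) =
            (fun i =>
              tok (x i) (y i) (if (i : ℕ) < n then 1 else 0)
                (if (i : ℕ) < n + n' then 1 else 0) (φx i) α w') ∧
          w' = w - η₂ • (fun j => (n : ℝ)⁻¹ * ∑ i : Fin (n + n' + 1),
              if (i : ℕ) < n then (α ⬝ᵥ φx i) * dℓ (w ⬝ᵥ φx i) (y i) * φx i j else 0)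
            + ε' ∧
          l2norm ε' ≤ ε * η₂ * B_x := by
  obtain ⟨a, b, c, -, hab, hg⟩ := happrox
  set R := max (B_w * B_x) (max B_y 1)
  have hR1 : 1 ≤ R := (le_max_right _ _).trans (le_max_right _ _)
  have hn0 : (n : ℝ) ≠ 0 := by positivity
  have hN0 : ((n + n' : ℕ) : ℝ) + 1 ≠ 0 := by positivity
  refine ⟨fun m => LinearMap.toMatrix' (queryLin d J p (a m) (b m) R),
    fun _ => LinearMap.toMatrix' (keyLin d J p),
    fun m => LinearMap.toMatrix' ((-(η₂ * (((n + n' : ℕ) : ℝ) + 1) * (n : ℝ)⁻¹ * c m)) •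
      (weightEmb d J p ∘ₗ featurePart d J p)), ?_⟩
  intro x y φx α w _ hφ _ hy hw hα
  let z : Fin (n + n' + 1) → Fin 3 → ℝ := fun j => ![w ⬝ᵥ φx j, y j, α ⬝ᵥ φx j]
  have hz : ∀ j i, |z j i| ≤ R := by
    intro j i
    fin_cases i
    · refine (abs_dotProduct_le w (φx j)).trans (le_trans ?_ (le_max_left _ _))
      exact mul_le_mul hw (hφ j) (Real.sqrt_nonneg _) hBw.le
    · exact (hy j).trans ((le_max_left _ _).trans (le_max_right _ _))
    · exact hα j
  let S : Fin (n + n' + 1) → ℝ := fun j => ∑ m, c m * relu (a m ⬝ᵥ z j + b m)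
  let δ : Fin (n + n' + 1) → ℝ := fun j =>
    if (j : ℕ) < n then (α ⬝ᵥ φx j) * dℓ (w ⬝ᵥ φx j) (y j) - S j else 0
  have hδ : ∀ j, |δ j| ≤ if (j : ℕ) < n then ε else 0 := by
    intro j
    by_cases hj : (j : ℕ) < n
    · simpa [δ, hj, S, z] using hg (z j) (hz j)
    · simp [δ, hj]
  have hgate : ∀ j m, relu (a m ⬝ᵥ z j + b m - R * (1 - if (j : ℕ) < n then 1 else 0)) =
      if (j : ℕ) < n then relu (a m ⬝ᵥ z j + b m) else 0 := by
    intro j m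
    by_cases hj : (j : ℕ) < n
    · simp [hj]
    · have := dotProduct_add_le hR1 (hab m) (hz j)
      simp [hj, relu, this]
  refine ⟨w - (η₂ * (n : ℝ)⁻¹) • ∑ j : Fin (n + n' + 1), (if (j : ℕ) < n then S j else 0) • φx j,
    (η₂ * (n : ℝ)⁻¹) • ∑ j, δ j • φx j, ?_, ?_, ?_⟩
  · funext i
    simp only [attn, LinearMap.toMatrix'_mulVec, queryLin_dotProduct_keyLin, LinearMap.smul_apply,
      LinearMap.comp_apply, featurePart_tok]
    simp only [← map_smul, ← map_sum, tok_add_weightEmb]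
    congr 1
    rw [sub_eq_add_neg, ← neg_smul, smul_sum, smul_sum]
    congr 1
    refine sum_congr rfl fun j _ => ?_
    simp only [smul_smul, ← sum_smul]
    congr 1
    have hrelu := hgate j
    simp only [z] at hrelu
    simp only [hrelu, S, z]
    split_ifs
    · rw [mul_sum, mul_sum]
      refine sum_congr rfl fun m _ => ?_
      field_simp
    · simp
  · ext k
    simp only [Pi.add_apply, Pi.sub_apply, Pi.smul_apply, Finset.sum_apply, smul_eq_mul]
    rw [sub_add, sub_right_inj, mul_assoc, mul_assoc, ← mul_sub, ← mul_sub, ← sum_sub_distrib]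
    congr 2
    refine sum_congr rfl fun j _ => ?_
    simp only [δ]
    split_ifs <;> ring
  · have hcard : ∑ j : Fin (n + n' + 1), (if (j : ℕ) < n then ε * B_x else 0) = n * (ε * B_x) := by
      rw [← sum_filter, sum_const, Fin.card_filter_val_lt, nsmul_eq_mul,
        min_eq_right (by omega)]
    have hsum : l2norm (∑ j, δ j • φx j) ≤ n * (ε * B_x) := by
      rw [← hcard]
      refine (l2norm_sum_le _ _).trans (sum_le_sum fun j _ => ?_)
      rw [l2norm_smul, ← ite_zero_mul]
      exact mul_le_mul (hδ j) (hφ j) (Real.sqrt_nonneg _) ((abs_nonneg _).trans (hδ j))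
    rw [l2norm_smul, abs_of_nonneg (by positivity)]
    calc η₂ * (n : ℝ)⁻¹ * l2norm (∑ j, δ j • φx j)
        ≤ η₂ * (n : ℝ)⁻¹ * (n * (ε * B_x)) := by gcongr
      _ = ε * η₂ * B_x := by field_simp
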